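/- arXiv:1906.06393 — 7 statements merged into one kernel-verified Lean document; each statement's English description precedes it below -/
import Mathlib

section
/- Let f be a monotone, normalized, submodular set function on subsets of a finite ground set V with f({j}) > 0 for every j ∈ V, and let κ ∈ [0,1] satisfy f(V) − f(V∖{j}) ≥ (1−κ)·f({j}) for every j ∈ V (i.e., κ is an upper bound on the total curvature of f). Then for every nonempty X ⊆ V: f(X) ≤ Σ_{j∈X} f({j}) ≤ K(|X|, κ) · f(X), where K(p, κ) = p / (1 + (1−κ)(p−1)). -/
open Finset in
/-- A normalized submodular function is bounded by the sum of its singleton values. -/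
theorem submodular_le_sum_singleton {V : Type*} [DecidableEq V] (f : Finset V → ℝ)
    (hsub : ∀ S T : Finset V, f S + f T ≥ f (S ∪ T) + f (S ∩ T)) (hnorm : f ∅ = 0)
    (X : Finset V) : f X ≤ ∑ j ∈ X, f {j} := by
  induction X using Finset.induction_on with
  | empty => simp [hnorm]
  | insert a s ha ih =>
    have h := hsub {a} s
    rw [singleton_inter_of_notMem ha, hnorm, ← insert_eq] at h
    rw [sum_insert ha]
    linarith

open Finset in
/-- If every marginal gain at the top is at least `c` times the singleton value, then adjoining `S`
to a disjoint set `T` gains at least `c` times the sum of the singleton values over `S`. -/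
theorem submodular_add_mul_sum_singleton_le {V : Type*} [Fintype V] [DecidableEq V]
    (f : Finset V → ℝ) (hsub : ∀ S T : Finset V, f S + f T ≥ f (S ∪ T) + f (S ∩ T)) (c : ℝ)
    (hc : ∀ j : V, f univ - f (univ.erase j) ≥ c * f {j})
    (T S : Finset V) (hd : Disjoint T S) : f T + c * ∑ j ∈ S, f {j} ≤ f (T ∪ S) := by
  induction S using Finset.induction_on with
  | empty => simp
  | insert a s ha ih =>
    obtain ⟨haT, hTs⟩ := disjoint_insert_right.mp hd
    have h := hsub (T ∪ insert a s) (univ.erase a)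
    have hunion : (T ∪ insert a s) ∪ univ.erase a = univ := by
      ext x; by_cases hx : x = a <;> simp [hx]
    have hinter : (T ∪ insert a s) ∩ univ.erase a = T ∪ s := by
      ext x; by_cases hx : x = a <;> simp [hx, haT, ha]
    rw [hunion, hinter] at h
    rw [sum_insert ha, mul_add]
    linarith [ih hTs, hc a]

/-- For a monotone normalized submodular `f` with positive singleton values and
total curvature at most `κ`, for every nonempty `X`:
`f X ≤ ∑_{j∈X} f {j} ≤ K(|X|, κ) · f X` where `K(p, κ) = p / (1 + (1−κ)(p−1))`. -/
theorem curvature_modular_upper_bound {V : Type*} [Fintype V] [DecidableEq V]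
    (f : Finset V → ℝ)
    (hsub : ∀ S T : Finset V, f S + f T ≥ f (S ∪ T) + f (S ∩ T))
    (hmono : ∀ S T : Finset V, S ⊆ T → f S ≤ f T)
    (hnorm : f ∅ = 0)
    (hpos : ∀ j : V, 0 < f {j})
    (κ : ℝ) (hκ0 : 0 ≤ κ) (hκ1 : κ ≤ 1)
    (hcurv : ∀ j : V, f Finset.univ - f (Finset.univ.erase j) ≥ (1 - κ) * f {j})
    (X : Finset V) (hX : X.Nonempty) :
    f X ≤ ∑ j ∈ X, f {j} ∧
    ∑ j ∈ X, f {j} ≤ ((X.card : ℝ) / (1 + (1 - κ) * ((X.card : ℝ) - 1))) * f X := by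
  refine ⟨submodular_le_sum_singleton f hsub hnorm X, ?_⟩
  have hcard : (1 : ℝ) ≤ X.card := by exact_mod_cast hX.card_pos
  have hden : 0 < 1 + (1 - κ) * ((X.card : ℝ) - 1) := by
    have := mul_nonneg (sub_nonneg.mpr hκ1) (sub_nonneg.mpr hcard)
    linarith
  have key : ∀ j ∈ X, f {j} + (1 - κ) * (∑ i ∈ X, f {i} - f {j}) ≤ f X := by
    intro j hj
    have h := submodular_add_mul_sum_singleton_le f hsub (1 - κ) hcurv {j} (X.erase j) (by simp)
    rw [← Finset.insert_eq, Finset.insert_erase hj] at h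
    rwa [← Finset.sum_erase_add X _ hj, add_sub_cancel_right]
  have hsum := Finset.sum_le_sum key
  rw [Finset.sum_add_distrib, ← Finset.mul_sum, Finset.sum_sub_distrib, Finset.sum_const,
    Finset.sum_const, nsmul_eq_mul, nsmul_eq_mul] at hsum
  rw [div_mul_eq_mul_div, le_div_iff₀ hden]
  linarith
end

section
/- Let f_1, …, f_l be monotone, normalized, submodular set functions on subsets of a finite ground set V with f_i({j}) > 0 for all i, j, and let κ ∈ [0,1] satisfy f_i(V) − f_i(V∖{j}) ≥ (1−κ)·f_i({j}) for every i and j. Let C be a nonempty family of nonempty subsets of V, let X* ∈ C minimize max_{i=1:l} f_i(X) over X ∈ C, let α ≥ 1, and let X̂ ∈ C satisfy max_{i=1:l} Σ_{j∈X̂} f_i({j}) ≤ α · min_{X∈C} max_{i=1:l} Σ_{j∈X} f_i({j}). Then max_{i=1:l} f_i(X̂) ≤ α · K(|X*|, κ) · max_{i=1:l} f_i(X*), where K(p, κ) = p / (1 + (1−κ)(p−1)). -/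
section Submodular

variable {V : Type*} [DecidableEq V] {g : Finset V → ℝ}

/-- A normalized submodular function is bounded above by its modular upper bound at `∅`. -/
lemma le_sum_singleton_of_submodular
    (hsub : ∀ S T : Finset V, g S + g T ≥ g (S ∪ T) + g (S ∩ T)) (hnorm : g ∅ = 0)
    (X : Finset V) : g X ≤ ∑ j ∈ X, g {j} := by
  induction X using Finset.induction_on with
  | empty => simp [hnorm]
  | insert a A ha ih =>
    rw [Finset.sum_insert ha]
    have h := hsub {a} A
    rw [← Finset.insert_eq, Finset.singleton_inter_of_notMem ha, hnorm] at h
    linarith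

/-- If every element of `V` has marginal gain at least `c * g {j}` with respect to `V \ {j}`,
then so does it with respect to every smaller set, and these gains add up. -/
lemma add_mul_sum_singleton_le_of_submodular [Fintype V]
    (hsub : ∀ S T : Finset V, g S + g T ≥ g (S ∪ T) + g (S ∩ T)) {c : ℝ}
    (hcurv : ∀ j : V, c * g {j} ≤ g Finset.univ - g (Finset.univ.erase j))
    (A B : Finset V) (hAB : Disjoint A B) : g A + c * ∑ j ∈ B, g {j} ≤ g (A ∪ B) := by
  induction B using Finset.induction_on with
  | empty => simp
  | insert b B hb ih =>
    rw [Finset.disjoint_insert_right] at hAB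
    have hbAB : b ∉ A ∪ B := by simp [hAB.1, hb]
    have h := hsub (insert b (A ∪ B)) (Finset.univ.erase b)
    have hunion : insert b (A ∪ B) ∪ Finset.univ.erase b = Finset.univ := by
      ext x
      by_cases hx : x = b <;> simp [hx]
    have hinter : insert b (A ∪ B) ∩ Finset.univ.erase b = A ∪ B := by
      rw [Finset.inter_erase, Finset.inter_univ, Finset.erase_insert hbAB]
    rw [hunion, hinter] at h
    rw [Finset.sum_insert hb, Finset.union_insert]
    linarith [ih hAB.2, hcurv b]

/-- The curvature bound on the modular upper bound of a submodular function at `∅`. -/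
lemma sum_singleton_mul_le_card_mul_of_submodular [Fintype V]
    (hsub : ∀ S T : Finset V, g S + g T ≥ g (S ∪ T) + g (S ∩ T)) {c : ℝ}
    (hcurv : ∀ j : V, c * g {j} ≤ g Finset.univ - g (Finset.univ.erase j))
    (X : Finset V) :
    (∑ j ∈ X, g {j}) * (1 + c * ((X.card : ℝ) - 1)) ≤ X.card * g X := by
  have h : ∀ j ∈ X, (1 - c) * g {j} + c * ∑ k ∈ X, g {k} ≤ g X := by
    intro j hj
    have hj' := add_mul_sum_singleton_le_of_submodular hsub hcurv {j} (X.erase j) (by simp)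
    rw [← Finset.insert_eq, Finset.insert_erase hj] at hj'
    rw [← Finset.add_sum_erase X _ hj]
    linarith
  have hsum := Finset.sum_le_sum h
  simp only [Finset.sum_add_distrib, ← Finset.mul_sum, Finset.sum_const, nsmul_eq_mul] at hsum
  linarith

end Submodular


/-- First-iteration guarantee of majorization-minimization for Robust-SubMin.
If `X*` minimizes `max_i f i X` over the nonempty family `C` of nonempty sets, and `X̂ ∈ C`
is an `α`-approximate minimizer of `max_i ∑_{j∈X} f i {j}` over `C`, then
`max_i f i X̂ ≤ α · K(|X*|, κ) · max_i f i X*` with `K(p, κ) = p/(1+(1−κ)(p−1))`. -/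
theorem mmin_first_iteration_guarantee {V : Type*} [Fintype V] [DecidableEq V]
    (l : ℕ) (hl : 0 < l)
    (f : Fin l → Finset V → ℝ)
    (hsub : ∀ i (S T : Finset V), f i S + f i T ≥ f i (S ∪ T) + f i (S ∩ T))
    (hmono : ∀ i (S T : Finset V), S ⊆ T → f i S ≤ f i T)
    (hnorm : ∀ i, f i ∅ = 0)
    (hpos : ∀ i (j : V), 0 < f i {j})
    (κ : ℝ) (hκ0 : 0 ≤ κ) (hκ1 : κ ≤ 1)
    (hcurv : ∀ i (j : V), f i Finset.univ - f i (Finset.univ.erase j) ≥ (1 - κ) * f i {j})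
    (C : Finset (Finset V)) (hC : C.Nonempty) (hCne : ∀ X ∈ C, X.Nonempty)
    (Xstar : Finset V) (hXstar : Xstar ∈ C)
    (hXstarOpt : ∀ X ∈ C,
      Finset.univ.sup' ⟨⟨0, hl⟩, Finset.mem_univ _⟩ (fun i => f i Xstar) ≤
        Finset.univ.sup' ⟨⟨0, hl⟩, Finset.mem_univ _⟩ (fun i => f i X))
    (α : ℝ) (hα : 1 ≤ α)
    (Xhat : Finset V) (hXhat : Xhat ∈ C)
    (happrox :
      Finset.univ.sup' ⟨⟨0, hl⟩, Finset.mem_univ _⟩ (fun i => ∑ j ∈ Xhat, f i {j}) ≤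
        α * C.inf' hC (fun X =>
          Finset.univ.sup' ⟨⟨0, hl⟩, Finset.mem_univ _⟩ (fun i => ∑ j ∈ X, f i {j}))) :
    Finset.univ.sup' ⟨⟨0, hl⟩, Finset.mem_univ _⟩ (fun i => f i Xhat) ≤
      α * ((Xstar.card : ℝ) / (1 + (1 - κ) * ((Xstar.card : ℝ) - 1))) *
        Finset.univ.sup' ⟨⟨0, hl⟩, Finset.mem_univ _⟩ (fun i => f i Xstar) := by
  have hne : (Finset.univ : Finset (Fin l)).Nonempty := ⟨⟨0, hl⟩, Finset.mem_univ _⟩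
  have hcard : (1 : ℝ) ≤ Xstar.card := by exact_mod_cast (hCne Xstar hXstar).card_pos
  have hden : 0 < 1 + (1 - κ) * ((Xstar.card : ℝ) - 1) := by
    have := mul_nonneg (sub_nonneg.2 hκ1) (sub_nonneg.2 hcard)
    linarith
  have hupper : Finset.univ.sup' hne (fun i => f i Xhat) ≤
      Finset.univ.sup' hne (fun i => ∑ j ∈ Xhat, f i {j}) :=
    Finset.sup'_mono_fun fun i _ => le_sum_singleton_of_submodular (hsub i) (hnorm i) Xhat
  have hopt : C.inf' hC (fun X => Finset.univ.sup' hne (fun i => ∑ j ∈ X, f i {j})) ≤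
      Finset.univ.sup' hne (fun i => ∑ j ∈ Xstar, f i {j}) :=
    Finset.inf'_le _ hXstar
  have hlower : Finset.univ.sup' hne (fun i => ∑ j ∈ Xstar, f i {j}) ≤
      (Xstar.card : ℝ) / (1 + (1 - κ) * ((Xstar.card : ℝ) - 1)) *
        Finset.univ.sup' hne (fun i => f i Xstar) := by
    refine Finset.sup'_le _ _ fun i _ => ?_
    rw [div_mul_eq_mul_div, le_div_iff₀ hden]
    refine (sum_singleton_mul_le_card_mul_of_submodular (hsub i) (hcurv i) Xstar).trans ?_
    gcongr
    exact Finset.le_sup' (fun i => f i Xstar) (Finset.mem_univ i)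
  rw [mul_assoc]
  refine (hupper.trans happrox).trans ?_
  gcongr
  exact hopt.trans hlower
end

section
/- Let f be a submodular set function on subsets of a finite ground set V and let X ⊆ V. Define m^f_{X,1}(Y) = f(X) − Σ_{j ∈ X∖Y} f(j | X∖{j}) + Σ_{j ∈ Y∖X} f(j | ∅), where f(j | S) = f(S∪{j}) − f(S). Then m^f_{X,1}(Y) ≥ f(Y) for every Y ⊆ V, and m^f_{X,1}(X) = f(X). -/
/-- Adding a disjoint set `B` to `A` gains at most the sum of the gains in the empty context. -/
theorem submodular_union_sub_le_sum_gain_empty {V : Type*} [DecidableEq V] {f : Finset V → ℝ}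
    (hsub : ∀ S T : Finset V, f S + f T ≥ f (S ∪ T) + f (S ∩ T))
    {A B : Finset V} (hAB : Disjoint A B) :
    f (A ∪ B) - f A ≤ ∑ j ∈ B, (f (insert j ∅) - f ∅) := by
  induction B using Finset.induction_on with
  | empty => simp
  | insert a B ha ih =>
    rw [Finset.disjoint_insert_right] at hAB
    have hsplit := hsub (A ∪ B) (insert a ∅)
    have hunion : (A ∪ B) ∪ insert a ∅ = A ∪ insert a B := by grind
    have hinter : (A ∪ B) ∩ insert a ∅ = ∅ := by grind
    rw [hunion, hinter] at hsplit
    rw [Finset.sum_insert ha]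
    linarith [ih hAB.2]

/-- Removing `D` from `X` loses at least the sum of the gains in the contexts `X.erase j`. -/
theorem submodular_sum_gain_erase_le_sub_sdiff {V : Type*} [DecidableEq V] {f : Finset V → ℝ}
    (hsub : ∀ S T : Finset V, f S + f T ≥ f (S ∪ T) + f (S ∩ T))
    {X D : Finset V} (hD : D ⊆ X) :
    ∑ j ∈ D, (f (insert j (X.erase j)) - f (X.erase j)) ≤ f X - f (X \ D) := by
  induction D using Finset.induction_on with
  | empty => simp
  | insert a D ha ih =>
    rw [Finset.insert_subset_iff] at hD
    have hsplit := hsub (X \ D) (X.erase a)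
    have hunion : (X \ D) ∪ X.erase a = X := by grind
    have hinter : (X \ D) ∩ X.erase a = X \ insert a D := by grind
    rw [hunion, hinter] at hsplit
    rw [Finset.sum_insert ha, Finset.insert_erase hD.1]
    linarith [ih hD.2]

/-- The modular upper bound
`m^f_{X,1}(Y) = f X − ∑_{j∈X∖Y} f(j | X∖{j}) + ∑_{j∈Y∖X} f(j | ∅)`
of a submodular `f` satisfies `m^f_{X,1}(Y) ≥ f Y` for all `Y`, and `m^f_{X,1}(X) = f X`. -/
theorem supergradient_upper_bound_one {V : Type*} [Fintype V] [DecidableEq V]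
    (f : Finset V → ℝ)
    (hsub : ∀ S T : Finset V, f S + f T ≥ f (S ∪ T) + f (S ∩ T))
    (X : Finset V) :
    (∀ Y : Finset V,
      f X - (∑ j ∈ X \ Y, (f (insert j (X.erase j)) - f (X.erase j)))
          + (∑ j ∈ Y \ X, (f (insert j ∅) - f ∅)) ≥ f Y) ∧
    f X - (∑ j ∈ X \ X, (f (insert j (X.erase j)) - f (X.erase j)))
        + (∑ j ∈ X \ X, (f (insert j ∅) - f ∅)) = f X := by
  refine ⟨fun Y => ?_, by simp⟩
  have hadd := submodular_union_sub_le_sum_gain_empty hsub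
    (Finset.disjoint_sdiff.mono_left Finset.inter_subset_left : Disjoint (X ∩ Y) (Y \ X))
  have hdel := submodular_sum_gain_erase_le_sub_sdiff hsub (Finset.sdiff_subset : X \ Y ⊆ X)
  have hunion : (X ∩ Y) ∪ (Y \ X) = Y := by grind
  rw [hunion] at hadd
  rw [Finset.sdiff_sdiff_self_left] at hdel
  linarith
end

section
/- Let f be a submodular set function on subsets of a finite ground set V and let X ⊆ V. Define m^f_{X,2}(Y) = f(X) − Σ_{j ∈ X∖Y} f(j | V∖{j}) + Σ_{j ∈ Y∖X} f(j | X), where f(j | S) = f(S∪{j}) − f(S). Then m^f_{X,2}(Y) ≥ f(Y) for every Y ⊆ V, and m^f_{X,2}(X) = f(X). -/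
/-- Diminishing returns: the gains of a submodular set function decrease with the context. -/
theorem submodular_gain_antitone {V : Type*} [DecidableEq V] {f : Finset V → ℝ}
    (hsub : ∀ S T : Finset V, f S + f T ≥ f (S ∪ T) + f (S ∩ T))
    {A B : Finset V} (hAB : A ⊆ B) {j : V} (hj : j ∉ B) :
    f (insert j B) - f B ≤ f (insert j A) - f A := by
  have h := hsub (insert j A) B
  rw [Finset.insert_union, Finset.union_eq_right.mpr hAB, Finset.insert_inter_of_notMem hj,
    Finset.inter_eq_left.mpr hAB] at h
  linarith

theorem submodular_union_le_add_sum_gain {V : Type*} [DecidableEq V] {f : Finset V → ℝ}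
    (hsub : ∀ S T : Finset V, f S + f T ≥ f (S ∪ T) + f (S ∩ T))
    {A D : Finset V} (hD : Disjoint A D) :
    f (A ∪ D) ≤ f A + ∑ j ∈ D, (f (insert j A) - f A) := by
  induction D using Finset.induction_on with
  | empty => simp
  | insert a D ha ih =>
    obtain ⟨haA, hD⟩ := Finset.disjoint_insert_right.mp hD
    have h := submodular_gain_antitone hsub (Finset.subset_union_left (s₁ := A) (s₂ := D))
      (j := a) (by simp [haA, ha])
    rw [Finset.sum_insert ha, Finset.union_insert]
    linarith [ih hD]

theorem submodular_add_sum_gain_univ_le_union {V : Type*} [Fintype V] [DecidableEq V]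
    {f : Finset V → ℝ}
    (hsub : ∀ S T : Finset V, f S + f T ≥ f (S ∪ T) + f (S ∩ T))
    {A D : Finset V} (hD : Disjoint A D) :
    f A + ∑ j ∈ D, (f (insert j (Finset.univ.erase j)) - f (Finset.univ.erase j))
      ≤ f (A ∪ D) := by
  induction D using Finset.induction_on with
  | empty => simp
  | insert a D ha ih =>
    obtain ⟨haA, hD⟩ := Finset.disjoint_insert_right.mp hD
    have h := submodular_gain_antitone hsub (A := A ∪ D) (B := Finset.univ.erase a) (j := a)
      (Finset.subset_erase.mpr ⟨Finset.subset_univ _, by simp [haA, ha]⟩)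
      (Finset.notMem_erase a _)
    rw [Finset.sum_insert ha, Finset.union_insert]
    linarith [ih hD]

/-- The modular upper bound
`m^f_{X,2}(Y) = f X − ∑_{j∈X∖Y} f(j | V∖{j}) + ∑_{j∈Y∖X} f(j | X)`
of a submodular `f` satisfies `m^f_{X,2}(Y) ≥ f Y` for all `Y`, and `m^f_{X,2}(X) = f X`. -/
theorem supergradient_upper_bound_two {V : Type*} [Fintype V] [DecidableEq V]
    (f : Finset V → ℝ)
    (hsub : ∀ S T : Finset V, f S + f T ≥ f (S ∪ T) + f (S ∩ T))
    (X : Finset V) :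
    (∀ Y : Finset V,
      f X - (∑ j ∈ X \ Y, (f (insert j (Finset.univ.erase j)) - f (Finset.univ.erase j)))
          + (∑ j ∈ Y \ X, (f (insert j X) - f X)) ≥ f Y) ∧
    f X - (∑ j ∈ X \ X, (f (insert j (Finset.univ.erase j)) - f (Finset.univ.erase j)))
        + (∑ j ∈ X \ X, (f (insert j X) - f X)) = f X := by
  refine ⟨fun Y => ?_, by simp⟩
  have hup := submodular_union_le_add_sum_gain hsub (Finset.disjoint_sdiff (s := X) (t := Y))
  have hlow := submodular_add_sum_gain_univ_le_union hsub
    (Finset.disjoint_sdiff (s := Y) (t := X))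
  rw [Finset.union_sdiff_self_eq_union] at hup hlow
  rw [Finset.union_comm] at hlow
  linarith
end

section
/- Let W be a finite set, let b be an integer with 1 ≤ b ≤ |W|, and let x : W → [0,1] satisfy Σ_{i∈W} x_i ≥ b. Set θ = 1/(|W| − b + 1). Then |{i ∈ W : x_i ≥ θ}| ≥ b. -/
/-- If `x : W → [0,1]` satisfies `∑_{i∈W} x i ≥ b` with `1 ≤ b ≤ |W|`,
then at least `b` elements of `W` satisfy `x i ≥ θ` for `θ = 1/(|W| − b + 1)`. -/
theorem threshold_rounding_feasibility {ι : Type*} [DecidableEq ι]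
    (W : Finset ι) (b : ℕ) (hb1 : 1 ≤ b) (hb2 : b ≤ W.card)
    (x : ι → ℝ) (hx : ∀ i ∈ W, 0 ≤ x i ∧ x i ≤ 1)
    (hsum : (b : ℝ) ≤ ∑ i ∈ W, x i) :
    b ≤ (W.filter (fun i => 1 / ((W.card : ℝ) - (b : ℝ) + 1) ≤ x i)).card := by
  have hbW : (b : ℝ) ≤ W.card := by exact_mod_cast hb2
  set d : ℝ := (W.card : ℝ) - (b : ℝ) + 1 with hd
  have hd1 : 1 ≤ d := by linarith
  have hθ1 : 1 / d ≤ 1 := (div_le_one (by linarith)).2 hd1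
  have hdθ : d * (1 / d) = 1 := mul_one_div_cancel (by linarith)
  by_contra! hlt
  have hcard := W.card_filter_add_card_filter_not (fun i => 1 / d ≤ x i)
  have hsplit := W.sum_filter_add_sum_filter_not (fun i => 1 / d ≤ x i) x
  set S := W.filter (fun i => 1 / d ≤ x i)
  set T := W.filter (fun i => ¬ 1 / d ≤ x i)
  have hS : ∑ i ∈ S, x i ≤ S.card := by
    simpa using S.sum_le_card_nsmul x 1 fun i hi => (hx i (Finset.mem_filter.1 hi).1).2
  have hTne : T.Nonempty := Finset.card_pos.1 (by omega)
  have hTlt : ∑ i ∈ T, x i < T.card * (1 / d) := by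
    rw [← nsmul_eq_mul, ← Finset.sum_const]
    exact Finset.sum_lt_sum_of_nonempty hTne fun i hi => not_le.1 (Finset.mem_filter.1 hi).2
  have hcard' : (S.card : ℝ) + T.card = W.card := by exact_mod_cast hcard
  have hSb : (S.card : ℝ) + 1 ≤ b := by exact_mod_cast hlt
  nlinarith [mul_nonneg (sub_nonneg.2 hSb) (sub_nonneg.2 hθ1)]
end

section
/- Let f_1, …, f_l be monotone, non-negative set functions on subsets of a finite ground set V with Lovász extensions f̂_i(x) = ∫_0^1 f_i({j : x_j ≥ t}) dt, and let C be a nonempty family of subsets of V. Suppose x̂ ∈ [0,1]^V satisfies max_{i=1:l} f̂_i(x̂) ≤ max_{i=1:l} f̂_i(1_X) for every X ∈ C (i.e., x̂ is at least as good as every integral feasible point for the relaxation). If θ ∈ (0,1] is such that the level set X_θ = {j ∈ V : x̂_j ≥ θ} belongs to C, then max_{i=1:l} f_i(X_θ) ≤ (1/θ) · min_{X∈C} max_{i=1:l} f_i(X). -/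
theorem Antitone.mul_le_intervalIntegral_zero_one {g : ℝ → ℝ} (hg : Antitone g)
    (hnn : ∀ t, 0 ≤ g t) {θ : ℝ} (hθ0 : 0 ≤ θ) (hθ1 : θ ≤ 1) :
    θ * g θ ≤ ∫ t in (0:ℝ)..1, g t := by
  have hint (a b : ℝ) : IntervalIntegrable g MeasureTheory.volume a b := hg.intervalIntegrable
  calc
    θ * g θ = ∫ _ in (0:ℝ)..θ, g θ := by simp
    _ ≤ ∫ t in (0:ℝ)..θ, g t :=
      intervalIntegral.integral_mono_on hθ0 (by simp) (hint _ _) fun _ ht => hg ht.2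
    _ ≤ (∫ t in (0:ℝ)..θ, g t) + ∫ t in θ..1, g t :=
      le_add_of_nonneg_right (intervalIntegral.integral_nonneg hθ1 fun t _ => hnn t)
    _ = ∫ t in (0:ℝ)..1, g t :=
      intervalIntegral.integral_add_adjacent_intervals (hint _ _) (hint _ _)

/-- The Lovász extension agrees with the set function on indicator vectors. -/
theorem intervalIntegral_levelSet_indicator {V : Type*} [Fintype V] [DecidableEq V]
    (f : Finset V → ℝ) (X : Finset V) :
    ∫ t in (0:ℝ)..1, f (Finset.univ.filter (fun j => t ≤ (if j ∈ X then (1:ℝ) else 0))) =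
      f X := by
  have h : ∀ t ∈ Set.Ioc (0:ℝ) 1,
      f (Finset.univ.filter (fun j => t ≤ (if j ∈ X then (1:ℝ) else 0))) = f X := by
    intro t ht
    congr 1
    ext j
    by_cases hj : j ∈ X <;> simp [hj, ht.1, ht.2]
  rw [intervalIntegral.integral_of_le zero_le_one,
    MeasureTheory.setIntegral_congr_fun measurableSet_Ioc h]
  simp


/-- Rounding guarantee of the continuous relaxation algorithm for
Robust-SubMin: if `x̂ ∈ [0,1]^V` is at least as good as every integral feasible point for
`max_i f̂ i`, and the level set `X_θ = {j : x̂ j ≥ θ}` is feasible, then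
`max_i f i X_θ ≤ (1/θ) · min_{X∈C} max_i f i X`. -/
theorem continuous_relaxation_rounding {V : Type*} [Fintype V] [DecidableEq V]
    (l : ℕ) (hl : 0 < l)
    (f : Fin l → Finset V → ℝ)
    (hmono : ∀ i (S T : Finset V), S ⊆ T → f i S ≤ f i T)
    (hnn : ∀ i (X : Finset V), 0 ≤ f i X)
    (C : Finset (Finset V)) (hC : C.Nonempty)
    (xhat : V → ℝ) (hxhat : ∀ j, 0 ≤ xhat j ∧ xhat j ≤ 1)
    (hrelax : ∀ X ∈ C,
      Finset.univ.sup' ⟨⟨0, hl⟩, Finset.mem_univ _⟩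
          (fun i => ∫ t in (0:ℝ)..1, f i (Finset.univ.filter (fun j => t ≤ xhat j))) ≤
        Finset.univ.sup' ⟨⟨0, hl⟩, Finset.mem_univ _⟩
          (fun i => ∫ t in (0:ℝ)..1,
            f i (Finset.univ.filter (fun j => t ≤ (if j ∈ X then (1:ℝ) else 0)))))
    (θ : ℝ) (hθ0 : 0 < θ) (hθ1 : θ ≤ 1)
    (hfeas : Finset.univ.filter (fun j => θ ≤ xhat j) ∈ C) :
    Finset.univ.sup' ⟨⟨0, hl⟩, Finset.mem_univ _⟩
        (fun i => f i (Finset.univ.filter (fun j => θ ≤ xhat j))) ≤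
      (1 / θ) *
        C.inf' hC (fun X => Finset.univ.sup' ⟨⟨0, hl⟩, Finset.mem_univ _⟩ (fun i => f i X)) := by
  simp only [intervalIntegral_levelSet_indicator] at hrelax
  have hlevel (i : Fin l) :
      θ * f i (Finset.univ.filter (fun j => θ ≤ xhat j)) ≤
        ∫ t in (0:ℝ)..1, f i (Finset.univ.filter (fun j => t ≤ xhat j)) :=
    Antitone.mul_le_intervalIntegral_zero_one
      (g := fun t => f i (Finset.univ.filter (fun j => t ≤ xhat j)))
      (fun _ _ hst => hmono i _ _ (Finset.monotone_filter_right _ fun _ _ h => hst.trans h))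
      (fun _ => hnn i _) hθ0.le hθ1
  refine Finset.sup'_le _ _ fun i _ => ?_
  rw [one_div, ← div_eq_inv_mul, le_div_iff₀' hθ0]
  refine Finset.le_inf' _ _ fun X hX => (hlevel i).trans (le_trans ?_ (hrelax X hX))
  exact Finset.le_sup'
    (fun i => ∫ t in (0:ℝ)..1, f i (Finset.univ.filter (fun j => t ≤ xhat j)))
    (Finset.mem_univ i)
end

section
/- Let f_1, …, f_l be set functions on subsets of a finite ground set V, let w_1, …, w_l : V → ℝ_{≥0} be non-negative weight vectors and β ≥ 1 satisfy √(w_i(X)) ≤ f_i(X) ≤ β·√(w_i(X)) for every i and X ⊆ V, where w_i(X) = Σ_{j∈X} w_i(j); let b_1, …, b_l > 0 and g_1, …, g_k be set functions. Let F = {X : f_i(X) ≤ b_i for all i} and F' = {X : w_i(X) ≤ b_i² for all i}. Then F ⊆ F'; moreover, if ε ∈ (0,1), L ≥ 1, and X̂ satisfies min_{j=1:k} g_j(X̂) ≥ (1−ε)·max_{X∈F'} min_{j=1:k} g_j(X) and w_i(X̂) ≤ b_i²·L for all i, then min_{j=1:k} g_j(X̂) ≥ (1−ε)·max_{X∈F}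 min_{j=1:k} g_j(X) and f_i(X̂) ≤ β·b_i·√L for all i. -/
/-- Guarantee-transfer step for the Ellipsoidal Approximation algorithm for
Robust-SCSK. With `√(w i X) ≤ f i X ≤ β·√(w i X)`, the feasible region
`F = {X : ∀ i, f i X ≤ b i}` is contained in `F' = {X : ∀ i, w i X ≤ b i²}`, and a
`(1−ε)`-optimal solution over `F'` with `w i X̂ ≤ b i²·L` is `(1−ε)`-optimal over `F` with
`f i X̂ ≤ β·b i·√L`. -/
theorem robust_scsk_ea_transfer {V : Type*} [Fintype V] [DecidableEq V]
    (l k : ℕ) (hl : 0 < l) (hk : 0 < k)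
    (f : Fin l → Finset V → ℝ)
    (w : Fin l → V → ℝ) (hw : ∀ i j, 0 ≤ w i j)
    (β : ℝ) (hβ : 1 ≤ β)
    (hsand : ∀ i (X : Finset V),
      Real.sqrt (∑ j ∈ X, w i j) ≤ f i X ∧ f i X ≤ β * Real.sqrt (∑ j ∈ X, w i j))
    (b : Fin l → ℝ) (hb : ∀ i, 0 < b i)
    (g : Fin k → Finset V → ℝ) :
    {X : Finset V | ∀ i, f i X ≤ b i} ⊆
      {X : Finset V | ∀ i, ∑ j ∈ X, w i j ≤ (b i) ^ 2} ∧
    (∀ (ε L : ℝ) (Xhat : Finset V), 0 < ε → ε < 1 → 1 ≤ L →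
      Finset.univ.inf' ⟨⟨0, hk⟩, Finset.mem_univ _⟩ (fun j => g j Xhat) ≥
        (1 - ε) * sSup ((fun X => Finset.univ.inf' ⟨⟨0, hk⟩, Finset.mem_univ _⟩
          (fun j => g j X)) '' {X : Finset V | ∀ i, ∑ j ∈ X, w i j ≤ (b i) ^ 2}) →
      (∀ i, ∑ j ∈ Xhat, w i j ≤ (b i) ^ 2 * L) →
      (Finset.univ.inf' ⟨⟨0, hk⟩, Finset.mem_univ _⟩ (fun j => g j Xhat) ≥
        (1 - ε) * sSup ((fun X => Finset.univ.inf' ⟨⟨0, hk⟩, Finset.mem_univ _⟩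
          (fun j => g j X)) '' {X : Finset V | ∀ i, f i X ≤ b i}) ∧
       ∀ i, f i Xhat ≤ β * b i * Real.sqrt L)) := by
  have hsub : {X : Finset V | ∀ i, f i X ≤ b i} ⊆
      {X : Finset V | ∀ i, ∑ j ∈ X, w i j ≤ (b i) ^ 2} := fun X hX i =>
    (Real.sqrt_le_left (hb i).le).1 ((hsand i X).1.trans (hX i))
  refine ⟨hsub, fun ε L Xhat _ hε1 hL hopt hfeas => ⟨?_, fun i => ?_⟩⟩
  · have hempty : (∅ : Finset V) ∈ {X : Finset V | ∀ i, f i X ≤ b i} := fun i =>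
      (hsand i ∅).2.trans (by simpa using (hb i).le)
    refine le_trans (mul_le_mul_of_nonneg_left ?_ (sub_nonneg.2 hε1.le)) hopt
    exact csSup_le_csSup (Set.toFinite _).bddAbove (Set.Nonempty.image _ ⟨∅, hempty⟩)
      (Set.image_mono hsub)
  · calc f i Xhat ≤ β * √(∑ j ∈ Xhat, w i j) := (hsand i Xhat).2
      _ ≤ β * √((b i) ^ 2 * L) := by
        gcongr
        exact hfeas i
      _ = β * b i * √L := by
        rw [Real.sqrt_mul (sq_nonneg _), Real.sqrt_sq (hb i).le, mul_assoc]
end
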